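/- A 2-cocycle f = f₁∘p₁ + f₂∘p₂ + f₃∘p₃ on g with values in z is a coboundary (i.e. of the form f(u,v) = −ℓ([u,v]) for a linear map ℓ: g → z) if and only if f₁ = 0, f₃ = 0, and there exists a linear map ℓ: A → Lin(k,z) with f̃₂(a)(x,y) = −ℓ(a)([x,y]) for all a ∈ A and x,y ∈ k. -/

import Mathlib

set_option linter.unusedSectionVars false
set_option synthInstance.maxHeartbeats 1000000
set_option maxHeartbeats 1000000
open scoped TensorProduct

namespace CurrentPaper

variable (K : Type*) [Field K] [CharZero K]

section Wedge

variable (V : Type*) [AddCommGroup V] [Module K V]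

/-- `x ∧ y = (1/2)(x ⊗ y - y ⊗ x)` inside `V ⊗ V`. -/
noncomputable def wedge (x y : V) : V ⊗[K] V := (2 : K)⁻¹ • (x ⊗ₜ[K] y - y ⊗ₜ[K] x)

/-- `x ∨ y = (1/2)(x ⊗ y + y ⊗ x)` inside `V ⊗ V`. -/
noncomputable def vee (x y : V) : V ⊗[K] V := (2 : K)⁻¹ • (x ⊗ₜ[K] y + y ⊗ₜ[K] x)

/-- `Λ²(V)` realized as the subspace of skew-symmetric tensors of `V ⊗ V`. -/
def lambda2 : Submodule K (V ⊗[K] V) := Submodule.span K {t | ∃ x y : V, t = wedge K V x y}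

/-- `S²(V)` realized as the subspace of symmetric tensors of `V ⊗ V`. -/
def sym2 : Submodule K (V ⊗[K] V) := Submodule.span K {t | ∃ x y : V, t = vee K V x y}

variable {V}

lemma wedge_mem (x y : V) : wedge K V x y ∈ lambda2 K V := Submodule.subset_span ⟨x, y, rfl⟩

lemma vee_mem (x y : V) : vee K V x y ∈ sym2 K V := Submodule.subset_span ⟨x, y, rfl⟩

end Wedge

section LieRelaxed

variable (L : Type*) [LieRing L] [Module K L]

/-- `∂(u ∧ v ∧ w) = ⁅u,v⁆ ∧ w + ⁅v,w⁆ ∧ u + ⁅w,u⁆ ∧ v`. -/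
noncomputable def dd (u v w : L) : L ⊗[K] L :=
  wedge K L ⁅u, v⁆ w + wedge K L ⁅v, w⁆ u + wedge K L ⁅w, u⁆ v

/-- `B₂(L)`, the space of 2-boundaries, i.e. the image of `∂ : Λ³(L) → Λ²(L)`. -/
def B2 : Submodule K (L ⊗[K] L) := Submodule.span K {t | ∃ u v w : L, t = dd K L u v w}

variable {L}

lemma dd_mem_lambda2 (u v w : L) : dd K L u v w ∈ lambda2 K L :=
  add_mem (add_mem (wedge_mem K _ _) (wedge_mem K _ _)) (wedge_mem K _ _)

lemma dd_mem_B2 (u v w : L) : dd K L u v w ∈ B2 K L := Submodule.subset_span ⟨u, v, w, rfl⟩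

end LieRelaxed

section Lie

variable (L : Type*) [LieRing L] [LieAlgebra K L]

/-- The bracket `b : L ⊗ L → L`, `u ⊗ v ↦ ⁅u,v⁆`, as a linear map. -/
noncomputable def bracketHom : L ⊗[K] L →ₗ[K] L :=
  TensorProduct.lift (LinearMap.mk₂ K (fun u v => ⁅u, v⁆) add_lie smul_lie lie_add lie_smul)

/-- `Z₂(L) = Λ²(L) ∩ ker b`, the space of 2-cycles. -/
noncomputable def Z2 : Submodule K (L ⊗[K] L) := lambda2 K L ⊓ LinearMap.ker (bracketHom K L)

/-- The derived algebra `L' = [L,L]`, as a subspace of `L`. -/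
def derived : Submodule K L := Submodule.span K {m | ∃ u v : L, m = ⁅u, v⁆}

end Lie

section Alg

variable (A : Type*) [CommRing A] [Algebra K A]

/-- `I_A ⊆ S²(A)`: the kernel of the multiplication map `S²(A) → A`. -/
noncomputable def ia : Submodule K (A ⊗[K] A) := sym2 K A ⊓ LinearMap.ker (LinearMap.mul' K A)

/-- `T(A) ⊆ Λ²(A)`: the span of the elements `ab ∧ c + bc ∧ a + ca ∧ b`. -/
def TA : Submodule K (A ⊗[K] A) :=
  Submodule.span K
    {t | ∃ a b c : A, t = wedge K A (a*b) c + wedge K A (b*c) a + wedge K A (c*a) b}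

/-- `T₀(A) ⊆ Λ²(A)`: the span of the elements `ab ∧ c + bc ∧ a + ca ∧ b - abc ∧ 1`. -/
def T0A : Submodule K (A ⊗[K] A) :=
  Submodule.span K
    {t | ∃ a b c : A,
      t = wedge K A (a*b) c + wedge K A (b*c) a + wedge K A (c*a) b - wedge K A (a*b*c) 1}

variable {A}

lemma TA_el_mem_lambda2 (a b c : A) :
    wedge K A (a*b) c + wedge K A (b*c) a + wedge K A (c*a) b ∈ lambda2 K A :=
  add_mem (add_mem (wedge_mem K _ _) (wedge_mem K _ _)) (wedge_mem K _ _)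

lemma T0A_el_mem_lambda2 (a b c : A) :
    wedge K A (a*b) c + wedge K A (b*c) a + wedge K A (c*a) b - wedge K A (a*b*c) 1 ∈
      lambda2 K A :=
  sub_mem (TA_el_mem_lambda2 K a b c) (wedge_mem K _ _)

lemma ia_el_mem (a b : A) : vee K A a b - vee K A (a * b) 1 ∈ ia K A := by
  refine Submodule.mem_inf.mpr ⟨sub_mem (vee_mem K a b) (vee_mem K _ _), ?_⟩
  simp only [LinearMap.mem_ker, map_sub, vee, map_smul, map_add, LinearMap.mul'_apply,
    mul_one, one_mul, mul_comm b a]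
  simp

end Alg

section Current

variable (A : Type*) [CommRing A] [Algebra K A]
variable (k : Type*) [LieRing k] [LieAlgebra K k]

lemma g_smul_lie (c : K) (x y : A ⊗[K] k) : ⁅c • x, y⁆ = c • ⁅x, y⁆ := by
  rw [← algebraMap_smul A c x, ← algebraMap_smul A c ⁅x, y⁆, smul_lie]

lemma g_lie_smul (c : K) (x y : A ⊗[K] k) : ⁅x, c • y⁆ = c • ⁅x, y⁆ := by
  rw [← algebraMap_smul A c y, ← algebraMap_smul A c ⁅x, y⁆, lie_smul]

/-- The bracket of the current algebra `g = A ⊗ k`, as a `K`-linear map `g ⊗ g → g`. -/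
noncomputable def gBracket : (A ⊗[K] k) ⊗[K] (A ⊗[K] k) →ₗ[K] A ⊗[K] k :=
  TensorProduct.lift (LinearMap.mk₂ K (fun u v => ⁅u, v⁆) add_lie
    (fun c x y => g_smul_lie K A k c x y) lie_add (fun c x y => g_lie_smul K A k c x y))

/-- `Z₂(g) = Λ²(g) ∩ ker b` for the current algebra `g = A ⊗ k`. -/
noncomputable def Z2g : Submodule K ((A ⊗[K] k) ⊗[K] (A ⊗[K] k)) :=
  lambda2 K (A ⊗[K] k) ⊓ LinearMap.ker (gBracket K A k)

/-- The first summand `Λ²(A) ⊗ S²(k)` of the decomposition of `Λ²(A ⊗ k)`. -/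
abbrev M1 := (↥(lambda2 K A)) ⊗[K] (↥(sym2 K k))

/-- The second summand `A ⊗ Λ²(k)` of the decomposition of `Λ²(A ⊗ k)`. -/
abbrev M2 := A ⊗[K] (↥(lambda2 K k))

/-- The third summand `I_A ⊗ Λ²(k)` of the decomposition of `Λ²(A ⊗ k)`. -/
abbrev M3 := (↥(ia K A)) ⊗[K] (↥(lambda2 K k))

/-- The target of the isomorphism `P = (p₁,p₂,p₃)`. -/
abbrev Wspace := M1 K A k × M2 K A k × M3 K A k

variable {A k}

/-- The property characterizing the linear isomorphism
`P = (p₁,p₂,p₃) : Λ²(A ⊗ k) ≅ (Λ²(A) ⊗ S²(k)) ⊕ (A ⊗ Λ²(k)) ⊕ (I_A ⊗ Λ²(k))`: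
`p₁(ax ∧ by) = a ∧ b ⊗ x ∨ y`, `p₂(ax ∧ by) = ab ⊗ x ∧ y`,
`p₃(ax ∧ by) = (a ∨ b - ab ∨ 1) ⊗ x ∧ y`. -/
def IsDecomposition (P : ↥(lambda2 K (A ⊗[K] k)) ≃ₗ[K] Wspace K A k) : Prop :=
  ∀ (a b : A) (x y : k),
    P ⟨wedge K (A ⊗[K] k) (a ⊗ₜ x) (b ⊗ₜ y), wedge_mem K _ _⟩ =
      ((⟨wedge K A a b, wedge_mem K a b⟩ ⊗ₜ[K] ⟨vee K k x y, vee_mem K x y⟩ : M1 K A k),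
       ((a * b) ⊗ₜ[K] ⟨wedge K k x y, wedge_mem K x y⟩ : M2 K A k),
       ((⟨vee K A a b - vee K A (a * b) 1, ia_el_mem K a b⟩ ⊗ₜ[K]
          ⟨wedge K k x y, wedge_mem K x y⟩ : M3 K A k)))

end Current

end CurrentPaper

namespace CurrentPaper

variable (K : Type*) [Field K] [CharZero K]
variable (A : Type*) [CommRing A] [Algebra K A]
variable (k : Type*) [LieRing k] [LieAlgebra K k]
variable (z : Type*) [AddCommGroup z] [Module K z]

/-- A `z`-valued linear map on `Λ²(g)` is a 2-cocycle iff it vanishes on `B₂(g)`. -/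
def IsCocycle (F : ↥(lambda2 K (A ⊗[K] k)) → z) : Prop :=
  ∀ t : ↥(lambda2 K (A ⊗[K] k)),
    (t : (A ⊗[K] k) ⊗[K] (A ⊗[K] k)) ∈ B2 K (A ⊗[K] k) → F t = 0

section Spans

variable {K}
variable {V W : Type*} [AddCommGroup V] [Module K V] [AddCommGroup W] [Module K W]
variable {z}

lemma tensor_eq_zero_of_span {M : Submodule K V} {N : Submodule K W} {s : Set V} {t : Set W}
    (hM : M = Submodule.span K s) (hN : N = Submodule.span K t) (f : M ⊗[K] N →ₗ[K] z)
    (h : ∀ (x : M) (y : N), (x : V) ∈ s → (y : W) ∈ t → f (x ⊗ₜ[K] y) = 0) : f = 0 := by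
  subst hM hN
  refine TensorProduct.ext' fun m n => ?_
  have hs := Submodule.span_span_coe_preimage (R := K) (s := s)
  have ht := Submodule.span_span_coe_preimage (R := K) (s := t)
  have key : ∀ x : Submodule.span K s, (x : V) ∈ s → ∀ n, f (x ⊗ₜ[K] n) = 0 := by
    intro x hx n
    have hn : n ∈ Submodule.span K ((↑) ⁻¹' t : Set (Submodule.span K t)) := ht ▸ trivial
    induction hn using Submodule.span_induction with
    | mem y hy => exact h x y hx hy
    | zero => simp
    | add a b _ _ ha hb => rw [TensorProduct.tmul_add, map_add, ha, hb, add_zero]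
    | smul c a _ ha => rw [TensorProduct.tmul_smul, map_smul, ha, smul_zero]
  have hm : m ∈ Submodule.span K ((↑) ⁻¹' s : Set (Submodule.span K s)) := hs ▸ trivial
  induction hm using Submodule.span_induction with
  | mem x hx => simpa using key x hx n
  | zero => simp
  | add a b _ _ ha hb =>
    rw [TensorProduct.add_tmul, map_add, ha, hb]
    simp
  | smul c a _ ha =>
    rw [← TensorProduct.smul_tmul', map_smul, ha]
    simp

variable (K)

/-- The wedge product as a bilinear map into `Λ²(V)`. -/
noncomputable def wedgeHom : V →ₗ[K] V →ₗ[K] lambda2 K V :=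
  LinearMap.mk₂ K (fun u v => ⟨wedge K V u v, wedge_mem K u v⟩)
    (fun _ _ _ => Subtype.ext <| by
      simp only [wedge, TensorProduct.add_tmul, TensorProduct.tmul_add, Submodule.coe_add]
      module)
    (fun _ _ _ => Subtype.ext <| by
      simp only [wedge, ← TensorProduct.smul_tmul', TensorProduct.tmul_smul, Submodule.coe_smul]
      module)
    (fun _ _ _ => Subtype.ext <| by
      simp only [wedge, TensorProduct.add_tmul, TensorProduct.tmul_add, Submodule.coe_add]
      module)
    (fun _ _ _ => Subtype.ext <| by
      simp only [wedge, ← TensorProduct.smul_tmul', TensorProduct.tmul_smul, Submodule.coe_smul]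
      module)

lemma wedge_swap (x y : V) : wedge K V y x = -wedge K V x y := by
  simp only [wedge]
  module

lemma vee_swap (x y : V) : vee K V y x = vee K V x y := by
  simp only [vee, add_comm]

end Spans

lemma mul'_vee (a b : A) : LinearMap.mul' K A (vee K A a b) = a * b := by
  simp only [vee, map_smul, map_add, LinearMap.mul'_apply, mul_comm b a]
  module

/-- `I_A` is spanned by the elements `a ∨ b - ab ∨ 1`. -/
lemma ia_eq_span :
    ia K A = Submodule.span K {t | ∃ a b : A, t = vee K A a b - vee K A (a * b) 1} := by
  apply le_antisymm
  · rintro t ⟨hsym, hker⟩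
    have hproj : ∃ c : A, c = LinearMap.mul' K A t ∧ t - vee K A c 1 ∈
        Submodule.span K {t | ∃ a b : A, t = vee K A a b - vee K A (a * b) 1} := by
      clear hker
      induction hsym using Submodule.span_induction with
      | mem t ht =>
        obtain ⟨a, b, rfl⟩ := ht
        exact ⟨_, (mul'_vee K A a b).symm, Submodule.subset_span ⟨a, b, rfl⟩⟩
      | zero => exact ⟨0, by simp, by simp [vee]⟩
      | add s t _ _ hs ht =>
        obtain ⟨c, hc, hs⟩ := hs
        obtain ⟨d, hd, ht⟩ := ht
        refine ⟨c + d, by rw [hc, hd, map_add], ?_⟩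
        convert add_mem hs ht using 1
        simp only [vee, TensorProduct.add_tmul, TensorProduct.tmul_add]
        module
      | smul r t _ ht =>
        obtain ⟨c, hc, ht⟩ := ht
        refine ⟨r • c, by rw [hc, map_smul], ?_⟩
        convert Submodule.smul_mem _ r ht using 1
        simp only [vee, ← TensorProduct.smul_tmul', TensorProduct.tmul_smul]
        module
    obtain ⟨c, hc, h⟩ := hproj
    rw [LinearMap.mem_ker.mp hker] at hc
    simpa [hc, vee] using h
  · rw [Submodule.span_le]
    rintro _ ⟨a, b, rfl⟩
    exact ia_el_mem K a b

/-- **description of coboundaries.** A 2-cocycle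
`f = f₁∘p₁ + f₂∘p₂ + f₃∘p₃` is a coboundary iff `f₁ = 0`, `f₃ = 0` and there is a linear
map `ℓ : A → Lin(k,z)` with `f̃₂(a)(x,y) = -ℓ(a)([x,y])`. -/
theorem statement11
    (P : ↥(lambda2 K (A ⊗[K] k)) ≃ₗ[K] Wspace K A k) (hP : IsDecomposition K P)
    (f1 : M1 K A k →ₗ[K] z) (f2 : M2 K A k →ₗ[K] z) (f3 : M3 K A k →ₗ[K] z)
    (hf : IsCocycle K A k z (fun t => f1 (P t).1 + f2 (P t).2.1 + f3 (P t).2.2)) :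
    (∃ ℓ : (A ⊗[K] k) →ₗ[K] z, ∀ u v : A ⊗[K] k,
        f1 (P ⟨wedge K (A ⊗[K] k) u v, wedge_mem K u v⟩).1 +
          f2 (P ⟨wedge K (A ⊗[K] k) u v, wedge_mem K u v⟩).2.1 +
          f3 (P ⟨wedge K (A ⊗[K] k) u v, wedge_mem K u v⟩).2.2 = -ℓ ⁅u, v⁆) ↔
      (f1 = 0 ∧ f3 = 0 ∧ ∃ ℓ : A →ₗ[K] (k →ₗ[K] z), ∀ (a : A) (x y : k),
        f2 (a ⊗ₜ[K] ⟨wedge K k x y, wedge_mem K x y⟩) = -(ℓ a ⁅x, y⁆)) := by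
  constructor
  · rintro ⟨ℓ, hℓ⟩
    have hpure : ∀ (a b : A) (x y : k),
        f1 (⟨wedge K A a b, wedge_mem K a b⟩ ⊗ₜ[K] ⟨vee K k x y, vee_mem K x y⟩) +
          f2 ((a * b) ⊗ₜ[K] ⟨wedge K k x y, wedge_mem K x y⟩) +
          f3 (⟨vee K A a b - vee K A (a * b) 1, ia_el_mem K a b⟩ ⊗ₜ[K]
            ⟨wedge K k x y, wedge_mem K x y⟩) = -ℓ ((a * b) ⊗ₜ[K] ⁅x, y⁆) := by
      intro a b x y
      have h := hℓ (a ⊗ₜ x) (b ⊗ₜ y)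
      rwa [hP, LieAlgebra.ExtendScalars.bracket_tmul] at h
    have hf1 : f1 = 0 := by
      refine tensor_eq_zero_of_span rfl rfl f1 ?_
      rintro ⟨_, _⟩ ⟨_, _⟩ ⟨a, b, rfl⟩ ⟨x, y, rfl⟩
      have h := hpure a b x y
      have h' := hpure b a x y
      have hw : (⟨wedge K A b a, wedge_mem K b a⟩ : lambda2 K A) =
          -⟨wedge K A a b, wedge_mem K a b⟩ := Subtype.ext (wedge_swap K a b)
      have hneg :
          f1 ((-⟨wedge K A a b, wedge_mem K a b⟩) ⊗ₜ[K] ⟨vee K k x y, vee_mem K x y⟩) =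
          -f1 (⟨wedge K A a b, wedge_mem K a b⟩ ⊗ₜ[K] ⟨vee K k x y, vee_mem K x y⟩) :=
        map_neg (f1 ∘ₗ (TensorProduct.mk K _ _).flip _) _
      simp only [hw, vee_swap K a b, mul_comm b a, hneg] at h'
      rw [← h, add_assoc, add_assoc] at h'
      have : IsAddTorsionFree z := .of_isTorsionFree K z
      exact self_eq_neg.mp (add_right_cancel h').symm
    subst hf1
    have hf2 : ∀ (a : A) (x y : k),
        f2 (a ⊗ₜ[K] ⟨wedge K k x y, wedge_mem K x y⟩) = -ℓ (a ⊗ₜ[K] ⁅x, y⁆) := by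
      intro a x y
      have h := hpure a 1 x y
      have h0 : (⟨vee K A a 1 - vee K A (a * 1) 1, ia_el_mem K a 1⟩ : ia K A) = 0 :=
        Subtype.ext (by simp)
      rw [h0, TensorProduct.zero_tmul, map_zero, add_zero, mul_one, LinearMap.zero_apply,
        zero_add] at h
      exact h
    refine ⟨rfl, ?_, TensorProduct.curry ℓ, hf2⟩
    refine tensor_eq_zero_of_span (ia_eq_span K A) rfl f3 ?_
    rintro ⟨_, _⟩ ⟨_, _⟩ ⟨a, b, rfl⟩ ⟨x, y, rfl⟩
    have h := hpure a b x y
    rw [hf2, LinearMap.zero_apply, zero_add] at h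
    exact add_eq_left.mp h
  · rintro ⟨rfl, rfl, ℓ, hℓ⟩
    refine ⟨TensorProduct.lift ℓ, fun u v => ?_⟩
    simp only [LinearMap.zero_apply, zero_add, add_zero]
    change f2 (P (wedgeHom K u v)).2.1 = _
    induction u using TensorProduct.induction_on with
    | zero => simp
    | add u u' hu hu' =>
      simp only [map_add, LinearMap.add_apply, Prod.snd_add, Prod.fst_add, hu, hu', add_lie,
        neg_add]
    | tmul a x =>
      induction v using TensorProduct.induction_on with
      | zero => simp
      | add v v' hv hv' =>
        simp only [map_add, Prod.snd_add, Prod.fst_add, hv, hv', lie_add, neg_add]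
      | tmul b y =>
        change f2 (P ⟨wedge K (A ⊗[K] k) (a ⊗ₜ x) (b ⊗ₜ y), wedge_mem K _ _⟩).2.1 = _
        rw [hP, LieAlgebra.ExtendScalars.bracket_tmul, TensorProduct.lift.tmul]
        exact hℓ (a * b) x y

end CurrentPaper
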